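/- arXiv:2302.06379 — 5 statements merged into one kernel-verified Lean document; each statement's English description precedes it below -/
import Mathlib

section
/- Let n be a natural number and let M, N : Matrix (Fin 2) (Fin n) ℝ be two real 2 × n matrices each of rank 2. Denote by p_M(i,j) = M(0,i)·M(1,j) − M(0,j)·M(1,i) and p_N(i,j) = N(0,i)·N(1,j) − N(0,j)·N(1,i) their Plücker coordinates. If there exists a nonzero real number c such that p_N(i,j) = c·p_M(i,j) for all i, j ∈ Fin n, then the linear span of the rows of M equals the linear span of the rows of N as subspaces of ℝⁿ (viewed as Fin n → ℝ). -/
theorem plucker_span_le (n : ℕ) (A B : Matrix (Fin 2) (Fin n) ℝ) (d : ℝ) (i j : Fin n)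
    (hp : A 0 i * A 1 j - A 0 j * A 1 i ≠ 0)
    (h : ∀ i j : Fin n,
      A 0 i * A 1 j - A 0 j * A 1 i = d * (B 0 i * B 1 j - B 0 j * B 1 i)) :
    Submodule.span ℝ (Set.range (fun i : Fin 2 => (A i : Fin n → ℝ))) ≤
      Submodule.span ℝ (Set.range (fun i : Fin 2 => (B i : Fin n → ℝ))) := by
  rw [Submodule.span_le]
  rintro _ ⟨r, rfl⟩
  have key : (A r : Fin n → ℝ) =
      ((A r i * d * B 1 j - A r j * d * B 1 i) / (A 0 i * A 1 j - A 0 j * A 1 i)) • B 0 +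
      ((A r j * d * B 0 i - A r i * d * B 0 j) / (A 0 i * A 1 j - A 0 j * A 1 i)) • B 1 := by
    funext k
    have h1 := h k j
    have h2 := h i k
    have h3 : A r k * (A 0 i * A 1 j - A 0 j * A 1 i) =
        A r i * (A 0 k * A 1 j - A 0 j * A 1 k) + A r j * (A 0 i * A 1 k - A 0 k * A 1 i) := by
      fin_cases r <;> simp <;> ring
    rw [h1, h2] at h3
    simp only [Pi.add_apply, Pi.smul_apply, smul_eq_mul]
    rw [div_mul_eq_mul_div, div_mul_eq_mul_div, ← add_div, eq_div_iff hp, h3]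
    ring
  show (A r : Fin n → ℝ) ∈ _
  rw [key]
  exact Submodule.add_mem _
    (Submodule.smul_mem _ _ (Submodule.subset_span ⟨0, rfl⟩))
    (Submodule.smul_mem _ _ (Submodule.subset_span ⟨1, rfl⟩))

theorem plucker_exists_ne (n : ℕ) (M : Matrix (Fin 2) (Fin n) ℝ) (hM : M.rank = 2) :
    ∃ i j : Fin n, M 0 i * M 1 j - M 0 j * M 1 i ≠ 0 := by
  by_contra! hc
  have hli : LinearIndependent ℝ M.row := by
    rw [linearIndependent_iff_card_eq_finrank_span, Set.finrank,
      ← Matrix.rank_eq_finrank_span_row, hM]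
    simp

  rw [Fintype.linearIndependent_iff] at hli
  have h0 : ∀ i, M 0 i = 0 := by
    intro i
    have := hli ![- M 1 i, M 0 i] (by
      funext k
      have := hc i k
      simp [Fin.sum_univ_two, Matrix.row]
      linarith) 1
    simpa using this
  have := hli ![1, 0] (by
    funext k
    simp [Fin.sum_univ_two, Matrix.row, h0]) 0
  simp at this


/-- The Plücker coordinates of a rank-2 `2 × n` real matrix, considered up to
nonzero simultaneous scaling, determine the row span: the Plücker embedding of
the Grassmannian `Gr(2,n)` is injective. -/
theorem plucker_determines_subspace (n : ℕ) (M N : Matrix (Fin 2) (Fin n) ℝ)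
    (hM : M.rank = 2) (hN : N.rank = 2)
    (h : ∃ c : ℝ, c ≠ 0 ∧ ∀ i j : Fin n,
      N 0 i * N 1 j - N 0 j * N 1 i = c * (M 0 i * M 1 j - M 0 j * M 1 i)) :
    Submodule.span ℝ (Set.range (fun i : Fin 2 => (M i : Fin n → ℝ))) =
      Submodule.span ℝ (Set.range (fun i : Fin 2 => (N i : Fin n → ℝ))) := by
  obtain ⟨c, hc, h⟩ := h
  obtain ⟨i, j, hij⟩ := plucker_exists_ne n M hM
  obtain ⟨k, l, hkl⟩ := plucker_exists_ne n N hN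
  apply le_antisymm
  · refine plucker_span_le n M N c⁻¹ i j hij fun a b => ?_
    rw [h a b, inv_mul_cancel_left₀ hc]
  · exact plucker_span_le n N M c k l hkl h
end

section
/- (Conway–Coxeter periodicity of frieze patterns.) Let n ≥ 1 be a natural number and let g : ℤ → ℤ → ℤ be a frieze pattern of width n, i.e.: (i) g(i,0) = 1 and g(i,n+1) = 1 for all i ∈ ℤ (the boundary rows consist of 1's); (ii) g(i,r) > 0 for all i ∈ ℤ and all r with 1 ≤ r ≤ n (all entries are positive integers); (iii) the diamond rule holds: g(i,r)·g(i+1,r) = g(i+1,r−1)·g(i,r+1) + 1 for all i ∈ ℤ and all r with 1 ≤ r ≤ n. Then g is periodic with period n + 3: g(i + n + 3, r) = g(i,r) for all i ∈ ℤ and all r with 0 ≤ r ≤ n + 1. -/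
/-- **Conway–Coxeter periodicity of frieze patterns.** A frieze pattern of
width `n` (boundary rows of `1`'s, positive entries, diamond rule) is periodic
with period `n + 3`. -/
theorem frieze_periodic (n : ℕ) (hn : 1 ≤ n) (g : ℤ → ℤ → ℤ)
    (htop : ∀ i : ℤ, g i 0 = 1)
    (hbot : ∀ i : ℤ, g i (n + 1) = 1)
    (hpos : ∀ i r : ℤ, 1 ≤ r → r ≤ n → 0 < g i r)
    (hdiamond : ∀ i r : ℤ, 1 ≤ r → r ≤ n →
      g i r * g (i + 1) r = g (i + 1) (r - 1) * g i (r + 1) + 1) :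
    ∀ i r : ℤ, 0 ≤ r → r ≤ n + 1 → g (i + n + 3) r = g i r := by
  have hR : ∀ r : ℤ, 1 ≤ r → r ≤ n → ∀ i : ℤ,
      g i (r + 1) = g (i + r) 1 * g i r - g i (r - 1) := by
    intro r hr
    induction r, hr using Int.le_induction with
    | base =>
      intro h i
      have := hdiamond i 1 le_rfl h
      simp only [sub_self, htop] at this ⊢
      linarith
    | succ r hr ih =>
      intro h i
      have h0 := ih (by omega) (i + 1)
      have d1 := hdiamond i r hr (by omega)
      have d2 := hdiamond i (r + 1) (by omega) h
      have hp := hpos (i + 1) r hr (by omega)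
      rw [show i + 1 + r = i + (r + 1) by ring] at h0
      rw [show r + 1 - 1 = r by ring] at d2 ⊢
      apply mul_left_cancel₀ hp.ne'
      linear_combination -d2 + d1 + g i (r + 1) * h0
  have hL : ∀ r : ℤ, 1 ≤ r → r ≤ n → ∀ i : ℤ,
      g i (r + 1) = g i 1 * g (i + 1) r - g (i + 2) (r - 1) := by
    intro r hr
    induction r, hr using Int.le_induction with
    | base =>
      intro h i
      have := hdiamond i 1 le_rfl h
      simp only [sub_self, htop] at this ⊢
      linarith
    | succ r hr ih =>
      intro h i
      have h0 := ih (by omega) i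
      have d1 := hdiamond (i + 1) r hr (by omega)
      have d2 := hdiamond i (r + 1) (by omega) h
      have hp := hpos (i + 1) r hr (by omega)
      rw [show i + 1 + 1 = i + 2 by ring] at d1
      rw [show r + 1 - 1 = r by ring] at d2 ⊢
      apply mul_left_cancel₀ hp.ne'
      linear_combination -d2 + d1 + g (i + 1) (r + 1) * h0
  have hn' : (1 : ℤ) ≤ n := by exact_mod_cast hn
  have hx : ∀ i : ℤ, g i n = g (i + n + 1) 1 := by
    intro i
    have h0 := hR n hn' le_rfl (i + 1)
    have d := hdiamond i n hn' le_rfl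
    have hp := hpos (i + 1) n hn' le_rfl
    rw [hbot] at h0 d
    rw [show i + 1 + (n : ℤ) = i + n + 1 by ring] at h0
    apply mul_left_cancel₀ hp.ne'
    linear_combination d + h0
  have hy : ∀ i : ℤ, g (i + 2) n = g i 1 := by
    intro i
    have h0 := hL n hn' le_rfl i
    have d := hdiamond (i + 1) n hn' le_rfl
    have hp := hpos (i + 1) n hn' le_rfl
    rw [hbot] at h0 d
    rw [show i + 1 + 1 = i + 2 by ring] at d
    apply mul_left_cancel₀ hp.ne'
    linear_combination d + h0
  have ha : ∀ i : ℤ, g (i + n + 3) 1 = g i 1 := by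
    intro i
    have := hx (i + 2)
    rw [hy, show i + 2 + (n : ℤ) + 1 = i + n + 3 by ring] at this
    exact this.symm
  have key : ∀ r : ℤ, 1 ≤ r → r ≤ n + 1 → ∀ i : ℤ,
      g (i + n + 3) r = g i r ∧ g (i + n + 3) (r - 1) = g i (r - 1) := by
    intro r hr
    induction r, hr using Int.le_induction with
    | base =>
      intro h i
      exact ⟨ha i, by simp [htop]⟩
    | succ r hr ih =>
      intro h i
      obtain ⟨h1, h2⟩ := ih (by omega) i
      rw [show r + 1 - 1 = r by ring]
      refine ⟨?_, h1⟩
      rw [hR r hr (by omega), hR r hr (by omega), h1, h2,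
        show i + n + 3 + r = (i + r) + n + 3 by ring, ha]
  intro i r h0 h1
  rcases h0.eq_or_lt with h | h
  · rw [← h, htop, htop]
  · exact (key r (by omega) h1 i).1
end

section
/- Let n ≥ 1 and let g, g' : ℤ → ℤ → ℤ both be frieze patterns of width n (satisfying the boundary condition g(i,0) = g(i,n+1) = 1, positivity g(i,r) > 0 for 1 ≤ r ≤ n, and the diamond rule g(i,r)·g(i+1,r) = g(i+1,r−1)·g(i,r+1) + 1 for 1 ≤ r ≤ n, and the same for g'). If g and g' agree on the second row, i.e. g(i,1) = g'(i,1) for all i ∈ ℤ, then g = g', i.e. g(i,r) = g'(i,r) for all i ∈ ℤ and all 0 ≤ r ≤ n + 1. -/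
/-- A frieze pattern is determined by its second row: two frieze patterns of the
same width `n` agreeing on row `1` agree everywhere. -/
theorem frieze_determined_by_second_row (n : ℕ) (hn : 1 ≤ n) (g g' : ℤ → ℤ → ℤ)
    (htop : ∀ i : ℤ, g i 0 = 1)
    (hbot : ∀ i : ℤ, g i (n + 1) = 1)
    (hpos : ∀ i r : ℤ, 1 ≤ r → r ≤ n → 0 < g i r)
    (hdiamond : ∀ i r : ℤ, 1 ≤ r → r ≤ n →
      g i r * g (i + 1) r = g (i + 1) (r - 1) * g i (r + 1) + 1)
    (htop' : ∀ i : ℤ, g' i 0 = 1)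
    (hbot' : ∀ i : ℤ, g' i (n + 1) = 1)
    (hpos' : ∀ i r : ℤ, 1 ≤ r → r ≤ n → 0 < g' i r)
    (hdiamond' : ∀ i r : ℤ, 1 ≤ r → r ≤ n →
      g' i r * g' (i + 1) r = g' (i + 1) (r - 1) * g' i (r + 1) + 1)
    (hrow1 : ∀ i : ℤ, g i 1 = g' i 1) :
    ∀ i r : ℤ, 0 ≤ r → r ≤ n + 1 → g i r = g' i r := by
  have key : ∀ k : ℕ, k ≤ n → ∀ i : ℤ, g i k = g' i k ∧ g i (k + 1) = g' i (k + 1) := by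
    intro k
    induction k with
    | zero =>
      intro _ i
      simp [htop, htop', hrow1]
    | succ k ih =>
      intro hk i
      have ih := ih (by omega)
      push_cast
      refine ⟨(ih i).2, ?_⟩
      have h1 := hdiamond i (k + 1) (by omega) (by omega)
      have h2 := hdiamond' i (k + 1) (by omega) (by omega)
      rw [add_sub_cancel_right] at h1 h2
      rw [← (ih i).2, ← (ih (i + 1)).2, ← (ih (i + 1)).1, h1] at h2
      have h0 : g (i + 1) k ≠ 0 := by
        rcases Nat.eq_zero_or_pos k with h | h
        · subst h
          simp [htop]
        · exact (hpos (i + 1) k (by omega) (by omega)).ne'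
      exact mul_left_cancel₀ h0 (add_right_cancel h2)
  intro i r h0 hr
  by_cases h : r ≤ n
  · obtain ⟨k, rfl⟩ := Int.eq_ofNat_of_zero_le h0
    exact (key k (by omega) i).1
  · have : r = n + 1 := by omega
    rw [this, hbot, hbot']
end

section
/- (Matrix mutation is an involution.) Let ι be a finite type with decidable equality, let B : Matrix ι ι ℤ be skew-symmetric (B(j,i) = −B(i,j) for all i, j), and fix k ∈ ι. Define the mutation μ_k(B) = B' by B'(i,j) = −B(i,j) if i = k or j = k, and B'(i,j) = B(i,j) + max(B(i,k),0)·max(B(k,j),0) − max(−B(i,k),0)·max(−B(k,j),0) otherwise. Then μ_k(μ_k(B)) = B. -/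
/-- The matrix mutation `μ_k` of a skew-symmetric integer matrix at a vertex `k`. -/
def matrixMutation {ι : Type*} [Fintype ι] [DecidableEq ι] (k : ι)
    (B : Matrix ι ι ℤ) : Matrix ι ι ℤ :=
  Matrix.of fun i j =>
    if i = k ∨ j = k then -B i j
    else B i j + max (B i k) 0 * max (B k j) 0 - max (-B i k) 0 * max (-B k j) 0

/-- **Matrix mutation is an involution**: mutating a skew-symmetric integer
matrix twice at the same vertex `k` returns the original matrix. -/
theorem matrixMutation_involutive {ι : Type*} [Fintype ι] [DecidableEq ι]
    (B : Matrix ι ι ℤ) (hskew : ∀ i j, B j i = -B i j) (k : ι) :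
    matrixMutation k (matrixMutation k B) = B := by
  ext i j
  by_cases h : i = k ∨ j = k
  · simp [matrixMutation, h]
  · simp only [matrixMutation, Matrix.of_apply, h, if_false, true_or, or_true, if_true, neg_neg]
    ring
end

section
/- (Hyperbolic Ptolemy relation for lambda lengths, upper half-plane model.) Let a, b, c, d be real numbers with a < b < c < d, regarded as ideal points on the boundary of the upper half-plane, and let h_a, h_b, h_c, h_d > 0 be positive reals (the Euclidean diameters of chosen horocycles centred at these points). Define the lambda length between two of the points x, y as λ(x,y) = |x − y| / √(h_x · h_y). Then λ(a,c)·λ(b,d) = λ(a,b)·λ(c,d) + λ(b,c)·λ(a,d). -/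
/-- **Hyperbolic Ptolemy relation for lambda lengths** in the upper half-plane
model: for ideal points `a < b < c < d` on the boundary with horocycles of
Euclidean diameters `ha, hb, hc, hd`, the lambda lengths
`λ(x,y) = |x - y| / √(h_x h_y)` satisfy `λ(a,c)·λ(b,d) = λ(a,b)·λ(c,d) + λ(b,c)·λ(a,d)`. -/
theorem hyperbolic_ptolemy (a b c d : ℝ) (hab : a < b) (hbc : b < c) (hcd : c < d)
    (ha hb hc hd : ℝ) (ha' : 0 < ha) (hb' : 0 < hb) (hc' : 0 < hc) (hd' : 0 < hd) :
    (|a - c| / Real.sqrt (ha * hc)) * (|b - d| / Real.sqrt (hb * hd)) =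
      (|a - b| / Real.sqrt (ha * hb)) * (|c - d| / Real.sqrt (hc * hd)) +
      (|b - c| / Real.sqrt (hb * hc)) * (|a - d| / Real.sqrt (ha * hd)) := by
  rw [abs_of_neg (by linarith : a - c < 0), abs_of_neg (by linarith : b - d < 0),
    abs_of_neg (by linarith : a - b < 0), abs_of_neg (by linarith : c - d < 0),
    abs_of_neg (by linarith : b - c < 0), abs_of_neg (by linarith : a - d < 0),
    Real.sqrt_mul ha'.le, Real.sqrt_mul hb'.le, Real.sqrt_mul ha'.le, Real.sqrt_mul hc'.le,
    Real.sqrt_mul hb'.le, Real.sqrt_mul ha'.le]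
  have h1 := (Real.sqrt_pos.mpr ha').ne'
  have h2 := (Real.sqrt_pos.mpr hb').ne'
  have h3 := (Real.sqrt_pos.mpr hc').ne'
  have h4 := (Real.sqrt_pos.mpr hd').ne'
  generalize Real.sqrt ha = p at *
  generalize Real.sqrt hb = q at *
  generalize Real.sqrt hc = r at *
  generalize Real.sqrt hd = s at *
  field_simp
  ring
end
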